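/- For every finite connected simple graph G, φ(G) ≤ ⌈π(G)/2⌉, where φ(G) is the pebbling number under the modified rules in which, before any standard pebbling moves are made, each pebble may simultaneously make one free move to an adjacent vertex without cost (and a pebble reaching the root by such a free move counts as solving). -/

import Mathlib

/-- A single pebbling move on `G`: remove two pebbles from a vertex `u`
and place one pebble on an adjacent vertex `v`. -/
def PebblingStep {V : Type*} [DecidableEq V] (G : SimpleGraph V) (C C' : V → ℕ) : Prop :=
  ∃ u v, G.Adj u v ∧ 2 ≤ C u ∧
    C' = Function.update (Function.update C u (C u - 2)) v (C v + 1)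

/-- Configuration `C` is `k`-fold `r`-solvable on `G`: some sequence of pebbling
moves results in at least `k` pebbles on `r`. -/
def PebbSolvable {V : Type*} [DecidableEq V] (G : SimpleGraph V) (C : V → ℕ) (r : V)
    (k : ℕ) : Prop :=
  ∃ C', Relation.ReflTransGen (PebblingStep G) C C' ∧ k ≤ C' r

/-- The `k`-fold pebbling number of `G`: the least `n` such that for every root `r`,
every configuration of size at least `n` is `k`-fold `r`-solvable. -/
noncomputable def kPebblingNumber {V : Type*} [Fintype V] [DecidableEq V]
    (G : SimpleGraph V) (k : ℕ) : ℕ :=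
  sInf {n | ∀ (r : V) (C : V → ℕ), n ≤ ∑ v, C v → PebbSolvable G C r k}

/-- The pebbling number of `G`. -/
noncomputable def pebblingNumber {V : Type*} [Fintype V] [DecidableEq V]
    (G : SimpleGraph V) : ℕ :=
  kPebblingNumber G 1

/-- `FreeMove G C C'` holds when `C'` is obtained from `C` by letting each pebble
simultaneously make at most one free move to an adjacent vertex (without cost). -/
def FreeMove {V : Type*} [Fintype V] [DecidableEq V] (G : SimpleGraph V)
    (C C' : V → ℕ) : Prop :=
  ∃ f : V → V → ℕ, (∀ u v, f u v ≠ 0 → u = v ∨ G.Adj u v) ∧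
    (∀ u, ∑ v, f u v = C u) ∧ (∀ v, C' v = ∑ u, f u v)

/-- The modified pebbling number `φ(G)`: the least `n` such that for every root `r`,
every configuration of size at least `n` can reach `r` after first allowing each
pebble one simultaneous free move, followed by standard pebbling moves. A pebble
arriving at `r` by its free move also counts (via the empty sequence of moves). -/
noncomputable def phiPebblingNumber {V : Type*} [Fintype V] [DecidableEq V]
    (G : SimpleGraph V) : ℕ :=
  sInf {n | ∀ (r : V) (C : V → ℕ), n ≤ ∑ v, C v →
    ∃ C', FreeMove G C C' ∧ PebbSolvable G C' r 1}

section Pebbling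

variable {V : Type*} [DecidableEq V] {G : SimpleGraph V}

theorem pebblingStep_iff {C C' : V → ℕ} :
    PebblingStep G C C' ↔ ∃ (u v : V) (X : V → ℕ), G.Adj u v ∧ C = X + Pi.single u 2 ∧
      C' = X + Pi.single v 1 := by
  constructor
  · rintro ⟨u, v, huv, h2, rfl⟩
    have hne := huv.ne
    refine ⟨u, v, Function.update C u (C u - 2), huv, ?_, ?_⟩ <;> ext w <;>
      by_cases hu : w = u <;> by_cases hv : w = v <;> subst_vars <;>
      simp_all
  · rintro ⟨u, v, X, huv, rfl, rfl⟩
    have hne := huv.ne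
    refine ⟨u, v, huv, by simp, ?_⟩
    ext w
    by_cases hu : w = u <;> by_cases hv : w = v <;> subst_vars <;>
      simp_all

theorem PebblingStep.add_right {C C' : V → ℕ} (h : PebblingStep G C C') (Y : V → ℕ) :
    PebblingStep G (C + Y) (C' + Y) := by
  rw [pebblingStep_iff] at h ⊢
  obtain ⟨u, v, X, huv, rfl, rfl⟩ := h
  exact ⟨u, v, X + Y, huv, add_right_comm _ _ _, add_right_comm _ _ _⟩

theorem reflTransGen_pebblingStep_add_right {C C' : V → ℕ}
    (h : Relation.ReflTransGen (PebblingStep G) C C') (Y : V → ℕ) :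
    Relation.ReflTransGen (PebblingStep G) (C + Y) (C' + Y) :=
  h.lift (· + Y) fun _ _ hs => hs.add_right Y

theorem exists_add_single {C : V → ℕ} {u : V} {n : ℕ} (h : n ≤ C u) :
    ∃ X : V → ℕ, C = X + Pi.single u n := by
  refine ⟨C - Pi.single u n, (tsub_add_cancel_of_le fun w => ?_).symm⟩
  by_cases hw : w = u <;> subst_vars <;> simp_all

theorem reflTransGen_pebblingStep_single {u v : V} (huv : G.Adj u v) (X : V → ℕ) (k : ℕ) :
    Relation.ReflTransGen (PebblingStep G)
      (X + Pi.single u (2 * k)) (X + Pi.single v k) := by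
  induction k generalizing X with
  | zero => simpa using Relation.ReflTransGen.refl
  | succ k ih =>
    have hstep : PebblingStep G (X + Pi.single u (2 * (k + 1)))
        (X + Pi.single v 1 + Pi.single u (2 * k)) := by
      refine pebblingStep_iff.2 ⟨u, v, X + Pi.single u (2 * k), huv, ?_, add_right_comm _ _ _⟩
      rw [add_assoc, ← Pi.single_add, mul_add, mul_one]
    refine .head hstep ?_
    convert ih (X + Pi.single v 1) using 1
    rw [add_assoc, ← Pi.single_add, add_comm k 1]

theorem pebbSolvable_of_walk {u r : V} (w : G.Walk u r) {C : V → ℕ} {k : ℕ}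
    (h : 2 ^ w.length * k ≤ C u) : PebbSolvable G C r k := by
  induction w generalizing C with
  | nil => exact ⟨C, .refl, by simpa using h⟩
  | @cons u v r huv p ih =>
    rw [SimpleGraph.Walk.length_cons, pow_succ', mul_assoc] at h
    obtain ⟨X, rfl⟩ := exists_add_single h
    obtain ⟨C', hC', hk⟩ := ih (C := X + Pi.single v (2 ^ p.length * k)) (by simp)
    exact ⟨C', (reflTransGen_pebblingStep_single huv X _).trans hC', hk⟩

variable [Fintype V]

theorem FreeMove.refl (C : V → ℕ) : FreeMove G C C := by
  refine ⟨fun u v => if u = v then C u else 0, fun u v h => ?_, fun u => ?_, fun v => ?_⟩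
  · simp_all
  · simp
  · simp

theorem FreeMove.add {C C' D D' : V → ℕ} (h : FreeMove G C C') (h' : FreeMove G D D') :
    FreeMove G (C + D) (C' + D') := by
  obtain ⟨f, hf, hfC, hfC'⟩ := h
  obtain ⟨g, hg, hgD, hgD'⟩ := h'
  refine ⟨f + g, fun u v huv => ?_, fun u => ?_, fun v => ?_⟩
  · by_cases hz : f u v = 0
    · exact hg u v fun hz' => huv (by simp [hz, hz'])
    · exact hf u v hz
  · simp [Finset.sum_add_distrib, hfC, hgD]
  · simp [Finset.sum_add_distrib, hfC', hgD']

theorem FreeMove.single {u v : V} (huv : G.Adj u v) :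
    FreeMove G (Pi.single u 1) (Pi.single v 1) := by
  refine ⟨fun a b => if a = u ∧ b = v then 1 else 0, fun a b h => ?_, fun a => ?_, fun b => ?_⟩
  · simp only [ne_eq, ite_eq_right_iff, one_ne_zero, imp_false, not_not] at h
    exact .inr (h.1 ▸ h.2 ▸ huv)
  · simp [ite_and, Pi.single_apply]
  · simp [ite_and, Pi.single_apply]

/-- Whatever is reachable from the doubled configuration `C + C` splits into two copies of the
untouched pebbles `A` of `C` and a configuration reachable after free moves of the others. -/
theorem exists_freeMove_of_reflTransGen_add_self {C D : V → ℕ}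
    (h : Relation.ReflTransGen (PebblingStep G) (C + C) D) :
    ∃ A M F B : V → ℕ, C = M + A ∧ FreeMove G M F ∧
      Relation.ReflTransGen (PebblingStep G) F B ∧ D = B + (A + A) := by
  induction h with
  | refl => exact ⟨C, 0, 0, 0, (zero_add C).symm, .refl 0, .refl, (zero_add _).symm⟩
  | tail _ hs ih =>
    obtain ⟨A, M, F, B, hC, hMF, hFB, rfl⟩ := ih
    obtain ⟨u, v, X, huv, hX, rfl⟩ := pebblingStep_iff.1 hs
    by_cases hB : 2 ≤ B u
    · obtain ⟨B, rfl⟩ := exists_add_single hB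
      rw [add_right_comm, add_left_inj] at hX
      subst hX
      exact ⟨A, M, F, B + Pi.single v 1, hC, hMF,
        hFB.tail (pebblingStep_iff.2 ⟨u, v, B, huv, rfl, rfl⟩), add_right_comm _ _ _⟩
    · have hA : 1 ≤ A u := by
        have := congrFun hX u
        simp only [Pi.add_apply, Pi.single_eq_same] at this
        omega
      obtain ⟨A, rfl⟩ := exists_add_single hA
      have hX' : X = B + (A + A) := by
        have hsingle : (Pi.single u 2 : V → ℕ) = Pi.single u 1 + Pi.single u 1 := by
          rw [← Pi.single_add]
        rw [hsingle, add_add_add_comm A, ← add_assoc, add_left_inj] at hX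
        exact hX.symm
      subst hX'
      exact ⟨A, M + Pi.single u 1, F + Pi.single v 1, B + Pi.single v 1,
        by rw [hC, add_assoc, add_comm A], hMF.add (.single huv),
        reflTransGen_pebblingStep_add_right hFB _, add_right_comm _ _ _⟩

theorem PebbSolvable.exists_freeMove {C : V → ℕ} {r : V} (h : PebbSolvable G (C + C) r 1) :
    ∃ C', FreeMove G C C' ∧ PebbSolvable G C' r 1 := by
  obtain ⟨D, hD, hr⟩ := h
  obtain ⟨A, M, F, B, rfl, hMF, hFB, rfl⟩ := exists_freeMove_of_reflTransGen_add_self hD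
  refine ⟨F + A, hMF.add (.refl A), B + A, reflTransGen_pebblingStep_add_right hFB A, ?_⟩
  simp only [Pi.add_apply] at hr ⊢
  omega

theorem SimpleGraph.Connected.pebbSolvable_of_pebblingNumber_le (hG : G.Connected) (r : V)
    {C : V → ℕ} (hC : pebblingNumber G ≤ ∑ v, C v) : PebbSolvable G C r 1 := by
  refine Nat.sInf_mem (s := {n | ∀ (r : V) (C : V → ℕ), n ≤ ∑ v, C v → PebbSolvable G C r 1})
    ⟨∑ _v : V, 2 ^ Fintype.card V, fun r C hC => ?_⟩ r C hC
  obtain ⟨u, -, hu⟩ := Finset.exists_le_of_sum_le ⟨r, Finset.mem_univ r⟩ hC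
  obtain ⟨w, hw⟩ := (hG.preconnected u r).exists_isPath
  refine pebbSolvable_of_walk w (le_trans ?_ hu)
  rw [mul_one]
  exact Nat.pow_le_pow_right two_pos hw.length_lt.le

end Pebbling

/-- For every finite connected simple graph `G`, `φ(G) ≤ ⌈π(G)/2⌉`. -/
theorem phiPebblingNumber_le {V : Type*} [Fintype V] [DecidableEq V]
    (G : SimpleGraph V) (hG : G.Connected) :
    phiPebblingNumber G ≤ ⌈(pebblingNumber G : ℚ) / 2⌉₊ := by
  refine Nat.sInf_le fun r C hC =>
    (hG.pebbSolvable_of_pebblingNumber_le r (C := C + C) ?_).exists_freeMove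
  rw [Nat.ceil_le, div_le_iff₀ two_pos, mul_two] at hC
  simp only [Pi.add_apply, Finset.sum_add_distrib]
  exact_mod_cast hC
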